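/- arXiv:2009.07554 — 5 statements merged into one kernel-verified Lean document; each statement's English description precedes it below -/
import Mathlib

section
/- If P(Y^i = Y ∧ Y^j ≠ Y) = 0 (as holds for the pair (i,j) with j > i under the strong dominance property), then the difference of error rates equals the disagreement probability: γ_i − γ_j = p_{ij}. -/
open MeasureTheory ProbabilityTheory

/-- If `P(Yⁱ = Y ∧ Yʲ ≠ Y) = 0` (as holds for a pair `(i,j)` with `j > i`
under the strong dominance property), then the difference of error rates equals the
disagreement probability: `γᵢ − γⱼ = pᵢⱼ`. -/
theorem error_rate_diff_eq_disagreement_of_strong_dominance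
    {Ω : Type*} [MeasurableSpace Ω] (P : Measure Ω) [IsProbabilityMeasure P]
    {K : ℕ} (Y : Ω → Bool) (Yarm : Fin K → Ω → Bool)
    (hY : Measurable Y) (hYarm : ∀ i, Measurable (Yarm i))
    (i j : Fin K)
    (hSD : P {ω | Yarm i ω = Y ω ∧ Yarm j ω ≠ Y ω} = 0) :
    (P {ω | Yarm i ω ≠ Y ω}).toReal - (P {ω | Yarm j ω ≠ Y ω}).toReal
      = (P {ω | Yarm i ω ≠ Yarm j ω}).toReal := by
  have hdisj : AEDisjoint P {ω | Yarm j ω ≠ Y ω} {ω | Yarm i ω ≠ Yarm j ω} := by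
    refine measure_mono_null ?_ hSD
    rintro ω ⟨hj, hij⟩
    simp only [Set.mem_ofPred_eq] at hj hij ⊢
    revert hj hij
    cases Yarm i ω <;> cases Yarm j ω <;> cases Y ω <;> simp
  have hunion : ({ω | Yarm j ω ≠ Y ω} ∪ {ω | Yarm i ω ≠ Yarm j ω} : Set Ω)
      =ᵐ[P] {ω | Yarm i ω ≠ Y ω} := by
    have hae : ∀ᵐ ω ∂P, ¬(Yarm i ω = Y ω ∧ Yarm j ω ≠ Y ω) := by
      simpa only [ae_iff, not_not] using hSD
    refine Filter.eventuallyEq_set.2 ?_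
    filter_upwards [hae] with ω hω
    simp only [Set.mem_union, Set.mem_ofPred_eq]
    revert hω
    cases Yarm i ω <;> cases Yarm j ω <;> cases Y ω <;> simp
  have hmeas : MeasurableSet {ω | Yarm i ω ≠ Yarm j ω} :=
    (measurableSet_eq_fun (hYarm i) (hYarm j)).compl
  rw [← measure_congr hunion, measure_union₀ hmeas.nullMeasurableSet hdisj,
    ENNReal.toReal_add (measure_ne_top _ _) (measure_ne_top _ _), add_sub_cancel_left]
end

section
/- For every arm j with j < i*, the cost gap to the optimal arm is bounded by the disagreement probability: C_{i*} − C_j ≤ p_{j,i*}, i.e., C_{i*} − C_j ≤ P(Y^j ≠ Y^{i*}). -/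
open MeasureTheory ProbabilityTheory

/-- Triangle inequality for the disagreement probability of functions. -/
theorem measureReal_ne_le_add {Ω α : Type*} [MeasurableSpace Ω] (P : Measure Ω)
    [IsFiniteMeasure P] (f g h : Ω → α) :
    P.real {ω | f ω ≠ h ω} ≤ P.real {ω | f ω ≠ g ω} + P.real {ω | g ω ≠ h ω} := by
  refine (measureReal_mono fun ω hω => ?_).trans (measureReal_union_le _ _)
  by_contra hn
  simp only [Set.mem_union, Set.mem_ofPred_eq, not_or, not_not] at hn
  exact hω (hn.1.trans hn.2)

/-- For every arm `j` with `j < i⋆` (where `i⋆` is the largest index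
attaining the minimum of `i ↦ γᵢ + Cᵢ`), the cost gap to the optimal arm is bounded by the
disagreement probability: `C_{i⋆} − C_j ≤ p_{j,i⋆} = P(Yʲ ≠ Y^{i⋆})`. -/
theorem cost_gap_le_disagreement_below_optimal
    {Ω : Type*} [MeasurableSpace Ω] (P : Measure Ω) [IsProbabilityMeasure P]
    {K : ℕ} (Y : Ω → Bool) (Yarm : Fin K → Ω → Bool)
    (hY : Measurable Y) (hYarm : ∀ i, Measurable (Yarm i))
    (γ : Fin K → ℝ) (hγ : ∀ i, γ i = (P {ω | Yarm i ω ≠ Y ω}).toReal)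
    (p : Fin K → Fin K → ℝ) (hp : ∀ i j, p i j = (P {ω | Yarm i ω ≠ Yarm j ω}).toReal)
    (c : Fin K → ℝ) (hc : ∀ i, 0 ≤ c i)
    (C : Fin K → ℝ) (hC : ∀ i, C i = ∑ k ∈ Finset.Iic i, c k)
    (istar : Fin K)
    (hmin : ∀ i, γ istar + C istar ≤ γ i + C i)
    (hmax : ∀ i, γ i + C i = γ istar + C istar → i ≤ istar) :
    ∀ j, j < istar → C istar - C j ≤ p j istar := by
  intro j _
  have htri := measureReal_ne_le_add P (Yarm j) (Yarm istar) Y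
  have hj := hmin j
  rw [hγ, hγ] at hj
  rw [hp]
  simp only [measureReal_def] at htri
  linarith
end

section
/- For every D > 0, every a ∈ (0,1), and every natural number n ≥ 1, the sum ∑_{x=1}^{n} 1/(e^{Dx} − 1) is at most ln(1/a)/D² + 1/((1 − a)·D). -/
lemma sum_exp_neg_mul_le {D : ℝ} (hD : 0 < D) (n : ℕ) :
    ∑ x ∈ Finset.Icc 1 n, Real.exp (-(D * x)) ≤ (1 - Real.exp (-(D * n))) / D := by
  induction n with
  | zero => simp
  | succ k ih =>
    rw [Finset.sum_Icc_succ_top (by omega)]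
    have hexp : Real.exp (-(D * k)) = Real.exp (-(D * (k + 1 : ℕ))) * Real.exp D := by
      rw [← Real.exp_add]
      congr 1
      push_cast
      ring
    have hpos := Real.exp_pos (-(D * (k + 1 : ℕ)))
    have hstep : Real.exp (-(D * (k + 1 : ℕ))) * (D + 1) ≤ Real.exp (-(D * k)) := by
      rw [hexp]
      exact mul_le_mul_of_nonneg_left (Real.add_one_le_exp D) hpos.le
    rw [le_div_iff₀ hD] at ih ⊢
    linarith

lemma card_filter_mul_le {D L : ℝ} (hD : 0 < D) (hL : 0 ≤ L) (n : ℕ) :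
    (((Finset.Icc 1 n).filter fun x : ℕ => D * x ≤ L).card : ℝ) ≤ L / D := by
  have hsub : ((Finset.Icc 1 n).filter fun x : ℕ => D * x ≤ L) ⊆
      Finset.Icc 1 ⌊L / D⌋₊ := by
    intro x hx
    simp only [Finset.mem_filter, Finset.mem_Icc] at hx ⊢
    refine ⟨hx.1.1, Nat.le_floor ?_⟩
    rw [le_div_iff₀ hD]
    linarith [hx.2]
  have hcard := Finset.card_le_card hsub
  rw [Nat.card_Icc, Nat.add_sub_cancel] at hcard
  exact (Nat.cast_le.mpr hcard).trans (Nat.floor_le (by positivity))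

lemma one_div_exp_sub_one_le_one_div {t : ℝ} (ht : 0 < t) :
    1 / (Real.exp t - 1) ≤ 1 / t :=
  one_div_le_one_div_of_le ht (by linarith [Real.add_one_le_exp t])

lemma one_div_exp_sub_one_le_exp_neg_div {t a : ℝ} (ha : a < 1) (ht : Real.exp (-t) ≤ a) :
    1 / (Real.exp t - 1) ≤ Real.exp (-t) / (1 - a) := by
  have hpos := Real.exp_pos (-t)
  have hmul : Real.exp t * Real.exp (-t) = 1 := by rw [← Real.exp_add]; simp
  have heq : 1 / (Real.exp t - 1) = Real.exp (-t) / (1 - Real.exp (-t)) := by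
    have h1 : 1 - Real.exp (-t) = Real.exp (-t) * (Real.exp t - 1) := by linarith
    rw [h1, div_mul_eq_div_div, div_self hpos.ne']
  rw [heq]
  exact div_le_div_of_nonneg_left hpos.le (by linarith) (by linarith)



/-- For every `D > 0`, every `a ∈ (0,1)`, and every natural number `n ≥ 1`,
`∑_{x=1}^{n} 1/(e^{Dx} − 1) ≤ ln(1/a)/D² + 1/((1 − a)·D)`. -/
theorem sum_one_div_exp_sub_one_le
    (D a : ℝ) (hD : 0 < D) (ha : a ∈ Set.Ioo (0 : ℝ) 1) (n : ℕ) (hn : 1 ≤ n) :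
    ∑ x ∈ Finset.Icc 1 n, 1 / (Real.exp (D * x) - 1)
      ≤ Real.log (1 / a) / D ^ 2 + 1 / ((1 - a) * D) := by
  obtain ⟨ha0, ha1⟩ := ha
  have hL : 0 ≤ Real.log (1 / a) := Real.log_nonneg (by rw [le_div_iff₀ ha0]; linarith)
  have ha' : 0 < 1 - a := by linarith
  have hterm : ∀ x ∈ Finset.Icc 1 n, 1 / (Real.exp (D * x) - 1) ≤
      (if D * x ≤ Real.log (1 / a) then 1 / D else 0) + Real.exp (-(D * x)) / (1 - a) := by
    intro x hx
    have hx1 : (1 : ℝ) ≤ x := by exact_mod_cast (Finset.mem_Icc.mp hx).1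
    split_ifs with h
    · have h1 := one_div_exp_sub_one_le_one_div (t := D * x) (by positivity)
      have h2 : 1 / (D * x) ≤ 1 / D := one_div_le_one_div_of_le hD (by nlinarith)
      have h3 : 0 ≤ Real.exp (-(D * x)) / (1 - a) := by positivity
      linarith
    · rw [zero_add]
      refine one_div_exp_sub_one_le_exp_neg_div ha1 ?_
      rw [← Real.le_log_iff_exp_le ha0]
      rw [one_div, Real.log_inv] at h
      linarith
  refine (Finset.sum_le_sum hterm).trans ?_
  rw [Finset.sum_add_distrib, ← Finset.sum_filter, Finset.sum_const, nsmul_eq_mul,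
    ← Finset.sum_div]
  refine add_le_add ?_ ?_
  · calc _ ≤ Real.log (1 / a) / D * (1 / D) :=
          mul_le_mul_of_nonneg_right (card_filter_mul_le hD hL n) (by positivity)
      _ = Real.log (1 / a) / D ^ 2 := by field_simp
  · have hsum : ∑ x ∈ Finset.Icc 1 n, Real.exp (-(D * x)) ≤ 1 / D :=
      (sum_exp_neg_mul_le hD n).trans
        (div_le_div_of_nonneg_right (by linarith [Real.exp_pos (-(D * n))]) hD.le)
    calc _ ≤ 1 / D / (1 - a) := div_le_div_of_nonneg_right hsum ha'.le
      _ = 1 / ((1 - a) * D) := by rw [div_div, mul_comm]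
end

section
/- Let ε ∈ (0,1) and 0 < x < y < z < 1. If d(y, z) = d(x, z)/(1 + ε), then y − x ≥ (ε/(1 + ε)) · d(x, z) / ln( z(1−x) / (x(1−z)) ). -/
/-- The Bernoulli Kullback–Leibler divergence
`d(x, μ) = x·ln(x/μ) + (1−x)·ln((1−x)/(1−μ))`. -/
noncomputable def klBern (x μ : ℝ) : ℝ :=
  x * Real.log (x / μ) + (1 - x) * Real.log ((1 - x) / (1 - μ))

/-- The Gibbs inequality for Bernoulli distributions. -/
lemma klBern_nonneg {x μ : ℝ} (hx : 0 < x) (hx1 : x < 1) (hμ : 0 < μ) (hμ1 : μ < 1) :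
    0 ≤ klBern x μ := by
  have mul_log_div_ge {a b : ℝ} (ha : 0 < a) (hb : 0 < b) : a - b ≤ a * Real.log (a / b) := by
    have h := mul_le_mul_of_nonneg_left (Real.one_sub_inv_le_log_of_pos (div_pos ha hb)) ha.le
    rwa [inv_div, mul_sub, mul_one, mul_div_cancel₀ _ ha.ne'] at h
  have h₁ := mul_log_div_ge hx hμ
  have h₂ := mul_log_div_ge (sub_pos.2 hx1) (sub_pos.2 hμ1)
  unfold klBern
  linarith

/-- The Bregman three-point identity for the Bernoulli divergence. -/
lemma klBern_three_point {x y z : ℝ} (hx : 0 < x) (hx1 : x < 1) (hy : 0 < y) (hy1 : y < 1)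
    (hz : 0 < z) (hz1 : z < 1) :
    (y - x) * Real.log (z * (1 - x) / (x * (1 - z))) =
      klBern x z - klBern y z + klBern y x := by
  have hx' := (sub_pos.2 hx1).ne'
  have hy' := (sub_pos.2 hy1).ne'
  have hz' := (sub_pos.2 hz1).ne'
  unfold klBern
  rw [Real.log_div (mul_ne_zero hz.ne' hx') (mul_ne_zero hx.ne' hz'),
    Real.log_mul hz.ne' hx', Real.log_mul hx.ne' hz', Real.log_div hx.ne' hz.ne',
    Real.log_div hx' hz', Real.log_div hy.ne' hz.ne', Real.log_div hy' hz',
    Real.log_div hy.ne' hx.ne', Real.log_div hy' hx']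
  ring

/-- Let `ε ∈ (0,1)` and `0 < x < y < z < 1`. If
`d(y, z) = d(x, z)/(1 + ε)`, then
`y − x ≥ (ε/(1 + ε)) · d(x, z) / ln(z(1−x)/(x(1−z)))`. -/
theorem diff_ge_of_klBern_ratio
    (ε x y z : ℝ) (hε : ε ∈ Set.Ioo (0 : ℝ) 1)
    (hx : 0 < x) (hxy : x < y) (hyz : y < z) (hz : z < 1)
    (hd : klBern y z = klBern x z / (1 + ε)) :
    ε / (1 + ε) * klBern x z / Real.log (z * (1 - x) / (x * (1 - z))) ≤ y - x := by
  have hy : 0 < y := hx.trans hxy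
  have hz0 : 0 < z := hy.trans hyz
  have hy1 : y < 1 := hyz.trans hz
  have hx1 : x < 1 := hxy.trans hy1
  have hlog : 0 < Real.log (z * (1 - x) / (x * (1 - z))) := by
    apply Real.log_pos
    rw [one_lt_div (mul_pos hx (sub_pos.2 hz))]
    linarith
  have hε1 : 1 + ε ≠ 0 := by linarith [hε.1]
  have hdiff : ε / (1 + ε) * klBern x z = klBern x z - klBern y z := by
    rw [hd]
    field_simp
    ring
  rw [div_le_iff₀ hlog, hdiff, klBern_three_point hx hx1 hy hy1 hz0 hz]
  linarith [klBern_nonneg hy hy1 hx hx1]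
end

section
/- Let n, k be natural numbers with 1 ≤ k < n, set x := k/n, and let y ∈ (x, 1). If Z is a random variable distributed according to the Beta distribution with parameters (k + 1, n − k), then P(Z > y) ≤ exp(−n·d(x, y)). -/
open MeasureTheory ProbabilityTheory

/-- The tail integral of an unnormalised Beta density is dominated by the function
`A * t ^ (j + 1) * (1 - t) ^ (m + 1)` to the right of the mode `x` of the latter,
as soon as this holds at `x`. -/
lemma integral_tail_le_of_le_at_mode {j m : ℕ} {A c x y : ℝ} (hc : 0 ≤ c) (hx : 0 < x)
    (hmode : ((j : ℝ) + 1) * (1 - x) = x * (m + 1)) (hxy : x ≤ y) (hy : y ≤ 1)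
    (hle : ∫ t in x..1, c * t ^ (j + 1) * (1 - t) ^ m ≤ A * x ^ (j + 1) * (1 - x) ^ (m + 1)) :
    ∫ t in y..1, c * t ^ (j + 1) * (1 - t) ^ m ≤ A * y ^ (j + 1) * (1 - y) ^ (m + 1) := by
  set f : ℝ → ℝ := fun t => c * t ^ (j + 1) * (1 - t) ^ m with hf
  have hfc : Continuous f := by fun_prop
  set H : ℝ → ℝ := fun t => A * t ^ (j + 1) * (1 - t) ^ (m + 1) - ∫ s in t..1, f s with hH
  set B : ℝ → ℝ := fun t => A * ((j + 1) * (1 - t) - t * (m + 1)) + c * t with hB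
  have hderiv (t : ℝ) : HasDerivAt H (t ^ j * (1 - t) ^ m * B t) t := by
    have h1 : HasDerivAt (fun u => ∫ s in u..1, f s) (-f t) t :=
      intervalIntegral.integral_hasDerivAt_left (hfc.intervalIntegrable _ _)
        (hfc.stronglyMeasurableAtFilter _ _) hfc.continuousAt
    have h2 := ((hasDerivAt_pow (j + 1) t).const_mul A).mul
      (((hasDerivAt_id t).const_sub 1).pow (m + 1))
    refine (h2.sub h1).congr_deriv ?_
    simp only [hf, hB, id, Nat.add_sub_cancel, Pi.pow_apply]
    push_cast
    ring
  have hcont : Continuous H := continuous_iff_continuousAt.2 fun t => (hderiv t).continuousAt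
  have hweight {t : ℝ} (h0 : x ≤ t) (h1 : t ≤ 1) : 0 ≤ t ^ j * (1 - t) ^ m :=
    mul_nonneg (pow_nonneg (hx.le.trans h0) _) (pow_nonneg (sub_nonneg.2 h1) _)
  have hBx : 0 ≤ B x := by
    have : B x = c * x := by simp only [hB]; rw [hmode]; ring
    rw [this]; positivity
  have hBlin (s t u : ℝ) : (u - s) * B t = (u - t) * B s + (t - s) * B u := by
    simp only [hB]; ring
  suffices h : 0 ≤ H y from sub_nonneg.1 h
  rcases le_or_gt 0 (B y) with hBy | hBy
  · have hmono : MonotoneOn H (Set.Icc x y) := by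
      refine monotoneOn_of_hasDerivWithinAt_nonneg (convex_Icc x y) hcont.continuousOn
        (fun t _ => (hderiv t).hasDerivWithinAt) fun t ht => ?_
      rw [interior_Icc] at ht
      refine mul_nonneg (hweight ht.1.le (ht.2.le.trans hy)) ?_
      refine nonneg_of_mul_nonneg_right ?_ (sub_pos.2 (ht.1.trans ht.2))
      rw [hBlin]
      exact add_nonneg (mul_nonneg (sub_nonneg.2 ht.2.le) hBx)
        (mul_nonneg (sub_nonneg.2 ht.1.le) hBy)
    exact (sub_nonneg.2 hle).trans
      (hmono (Set.left_mem_Icc.2 hxy) (Set.right_mem_Icc.2 hxy) hxy)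
  · have hlt : x < y := hxy.lt_of_ne fun h => by rw [h] at hBx; exact hBy.not_ge hBx
    have hanti : AntitoneOn H (Set.Icc y 1) := by
      refine antitoneOn_of_hasDerivWithinAt_nonpos (convex_Icc y 1) hcont.continuousOn
        (fun t _ => (hderiv t).hasDerivWithinAt) fun t ht => ?_
      rw [interior_Icc] at ht
      refine mul_nonpos_of_nonneg_of_nonpos (hweight (hxy.trans ht.1.le) ht.2.le) ?_
      have := hBlin x y t
      have h1 : 0 ≤ (t - y) * B x := mul_nonneg (sub_nonneg.2 ht.1.le) hBx
      have h2 : (t - x) * B y ≤ 0 :=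
        mul_nonpos_of_nonneg_of_nonpos (sub_nonneg.2 (hxy.trans ht.1.le)) hBy.le
      refine nonpos_of_mul_nonpos_right (a := y - x) ?_ (sub_pos.2 hlt)
      linarith
    have h := hanti (Set.left_mem_Icc.2 hy) (Set.right_mem_Icc.2 hy) hy
    simpa [hH] using h

/-- The upper tail of a measure on `[0, 1]` with a continuous nonnegative density. -/
lemma real_withDensity_Icc_Ioi {f : ℝ → ℝ} (hf : Continuous f)
    (hf0 : ∀ t ∈ Set.Icc (0 : ℝ) 1, 0 ≤ f t) {y : ℝ} (hy : y ∈ Set.Icc (0 : ℝ) 1) :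
    ((volume.restrict (Set.Icc (0 : ℝ) 1)).withDensity
      (fun t => ENNReal.ofReal (f t)) (Set.Ioi y)).toReal = ∫ t in y..1, f t := by
  have hset : Set.Ioi y ∩ Set.Icc 0 1 = Set.Ioc y 1 := by
    ext t
    simp only [Set.mem_inter_iff, Set.mem_Ioi, Set.mem_Icc, Set.mem_Ioc]
    exact ⟨fun h => ⟨h.1, h.2.2⟩, fun h => ⟨h.1, hy.1.trans h.1.le, h.2⟩⟩
  rw [withDensity_apply _ measurableSet_Ioi, Measure.restrict_restrict measurableSet_Ioi, hset,
    intervalIntegral.integral_of_le hy.2, integral_eq_lintegral_of_nonneg_ae]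
  · exact (ae_restrict_iff' measurableSet_Ioc).2
      (.of_forall fun t ht => hf0 t ⟨hy.1.trans ht.1.le, ht.2⟩)
  · exact hf.aestronglyMeasurable

/-- The Chernoff bound of the binomial distribution as a product of powers. -/
lemma exp_neg_mul_klBern {n k : ℕ} (hkn : k ≤ n) {x y : ℝ} (hxn : n * x = k)
    (hx : x ∈ Set.Ioo (0 : ℝ) 1) (hy : y ∈ Set.Ioo (0 : ℝ) 1) :
    Real.exp (-(n : ℝ) * klBern x y) = (y / x) ^ k * ((1 - y) / (1 - x)) ^ (n - k) := by
  have h1 : 0 < y / x := div_pos hy.1 hx.1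
  have h2 : 0 < (1 - y) / (1 - x) := div_pos (sub_pos.2 hy.2) (sub_pos.2 hx.2)
  rw [← Real.exp_log (mul_pos (pow_pos h1 k) (pow_pos h2 (n - k))),
    Real.log_mul (pow_pos h1 k).ne' (pow_pos h2 _).ne', Real.log_pow, Real.log_pow,
    Nat.cast_sub hkn, klBern, ← inv_div y x, ← inv_div (1 - y) (1 - x), Real.log_inv, Real.log_inv,
    ← hxn]
  congr 1
  ring

/-- Let `1 ≤ k < n`, set `x := k/n`, and let `y ∈ (x, 1)`. If `Z` is a
random variable distributed according to the Beta distribution with parameters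
`(k + 1, n − k)` (density on `[0,1]` proportional to `t^k (1−t)^{n−k−1}`), then
`P(Z > y) ≤ exp(−n·d(x, y))`. -/
theorem beta_tail_le_exp_neg_klBern
    {Ω : Type*} [MeasurableSpace Ω] (P : Measure Ω) [IsProbabilityMeasure P]
    (n k : ℕ) (hk : 1 ≤ k) (hkn : k < n)
    (x : ℝ) (hx : x = (k : ℝ) / n) (y : ℝ) (hy : y ∈ Set.Ioo x 1)
    (Z : Ω → ℝ) (hZm : Measurable Z)
    (c : ℝ) (hc : 0 < c)
    (hZ : Measure.map Z P =
      (volume.restrict (Set.Icc (0 : ℝ) 1)).withDensity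
        (fun t => ENNReal.ofReal (c * t ^ k * (1 - t) ^ (n - k - 1)))) :
    (P {ω | y < Z ω}).toReal ≤ Real.exp (-(n : ℝ) * klBern x y) := by
  obtain ⟨j, rfl⟩ : ∃ j, k = j + 1 := ⟨k - 1, by lia⟩
  obtain ⟨m, rfl⟩ : ∃ m, n = j + 1 + (m + 1) := ⟨n - (j + 1) - 1, by lia⟩
  have hsub : j + 1 + (m + 1) - (j + 1) = m + 1 := by lia
  rw [hsub, Nat.add_sub_cancel] at hZ
  have hxn : ((j + 1 + (m + 1) : ℕ) : ℝ) * x = (j + 1 : ℕ) := by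
    rw [hx]; field_simp
  have hx0 : 0 < x := by rw [hx]; positivity
  have hx1 : x < 1 := hy.1.trans hy.2
  have hx1' : 0 < 1 - x := sub_pos.2 hx1
  have htail {z : ℝ} (hz : z ∈ Set.Icc (0 : ℝ) 1) :
      (P {ω | z < Z ω}).toReal = ∫ t in z..1, c * t ^ (j + 1) * (1 - t) ^ m := by
    rw [← real_withDensity_Icc_Ioi (by fun_prop) (fun t ht => ?_) hz, ← hZ,
      Measure.map_apply hZm measurableSet_Ioi]
    · rfl
    · exact mul_nonneg (mul_nonneg hc.le (pow_nonneg ht.1 _)) (pow_nonneg (sub_nonneg.2 ht.2) _)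
  rw [exp_neg_mul_klBern hkn.le hxn ⟨hx0, hx1⟩ ⟨hx0.trans hy.1, hy.2⟩, hsub,
    htail ⟨(hx0.trans hy.1).le, hy.2.le⟩]
  have hmode : ((j : ℝ) + 1) * (1 - x) = x * (m + 1) := by
    push_cast at hxn; linarith
  refine (integral_tail_le_of_le_at_mode (A := (x ^ (j + 1) * (1 - x) ^ (m + 1))⁻¹)
    hc.le hx0 hmode hy.1.le hy.2.le ?_).trans_eq ?_
  · rw [← htail ⟨hx0.le, hx1.le⟩, mul_assoc, inv_mul_cancel₀ (by positivity)]
    exact measureReal_le_one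
  · rw [div_pow, div_pow]
    field_simp
end
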